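/- The intersection B_{α-1} ∩ B_{α²-α} is the singleton { -1 }. -/

import Mathlib

open Complex Filter Topology

noncomputable section

/-- The word `w₁w₂w₃w₄` is lexicographically smaller than the word `(a-1)(a-1)01`. -/
def WordLt (a : ℤ) (w₁ w₂ w₃ w₄ : ℤ) : Prop :=
  w₁ < a - 1 ∨ (w₁ = a - 1 ∧ (w₂ < a - 1 ∨ (w₂ = a - 1 ∧ (w₃ < 0 ∨ (w₃ = 0 ∧ w₄ < 1)))))

/-- A sequence of integers `(c i)_{i ≥ k}` with `0 ≤ c i ≤ a-1` is admissible if for every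
`i ≥ k+3` the word `c i, c (i-1), c (i-2), c (i-3)` is lexicographically smaller
than `(a-1)(a-1)01`. (Values of `c` below index `k` are irrelevant.) -/
def Admissible (a k : ℤ) (c : ℤ → ℤ) : Prop :=
  (∀ i, k ≤ i → 0 ≤ c i ∧ c i ≤ a - 1) ∧
  (∀ i, k + 3 ≤ i → WordLt a (c i) (c (i - 1)) (c (i - 2)) (c (i - 3)))

/-- The Rauzy fractal `R_a = { Σ_{i=2}^∞ c_i α^i : (c_i)_{i≥2} admissible }`. -/
def Rauzy (a : ℤ) (α : ℂ) : Set ℂ :=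
  {z | ∃ c : ℤ → ℤ, Admissible a 2 c ∧
    z = ∑' n : ℕ, (c ((n : ℤ) + 2) : ℂ) * α ^ (n + 2)}

/-- `B_v = R_a ∩ (R_a + v)`. -/
def BSet (a : ℤ) (α : ℂ) (v : ℂ) : Set ℂ :=
  Rauzy a α ∩ ((· + v) '' Rauzy a α)

/-- `B'_{α-1}`: points of `B_{α-1}` admitting an admissible expansion
`z = α - 1 + Σ_{i=3}^∞ c_i α^i` with `c 3 ≠ a-1`. -/
def Bprime (a : ℤ) (α : ℂ) : Set ℂ :=
  {z | z ∈ BSet a α (α - 1) ∧ ∃ c : ℤ → ℤ, Admissible a 3 c ∧ c 3 ≠ a - 1 ∧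
    z = α - 1 + ∑' n : ℕ, (c ((n : ℤ) + 3) : ℂ) * α ^ (n + 3)}

/-- `g_{2k+1}(z) = -1 - k α³ + α³ z`. -/
def gOdd (α : ℂ) (k : ℤ) (z : ℂ) : ℂ := -1 - (k : ℂ) * α ^ 3 + α ^ 3 * z

/-- `g_{2k}(z) = α - 1 + (a-1-k) α³ + α² z`. -/
def gEven (a : ℤ) (α : ℂ) (k : ℤ) (z : ℂ) : ℂ :=
  α - 1 + ((a : ℂ) - 1 - (k : ℂ)) * α ^ 3 + α ^ 2 * z

/-- Basic facts about the non-real root. -/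
lemma root_facts (a : ℤ) (ha : 3 ≤ a) (α : ℂ)
    (hroot : α ^ 3 - (a : ℂ) * α ^ 2 + α - 1 = 0) (hα : α.im ≠ 0) :
    1 < (a : ℝ) - 2 * α.re ∧ ‖α‖ < 1 := by
  have hre := congrArg Complex.re hroot
  have him := congrArg Complex.im hroot
  simp [pow_succ] at hre him
  set r := α.re
  set s := α.im
  have ha' : (3 : ℝ) ≤ a := by exact_mod_cast ha
  have h1 : 3 * r ^ 2 - s ^ 2 - 2 * a * r + 1 = 0 := by
    apply mul_left_cancel₀ hα
    linear_combination him
  set β : ℝ := a - 2 * r with hβ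
  have e1 : β * (r ^ 2 + s ^ 2) = 1 := by
    rw [hβ]; linear_combination hre - r * h1
  have e2 : (r ^ 2 + s ^ 2) + β * (2 * r) = 1 := by
    rw [hβ]; linear_combination -h1
  have hs : 0 < s ^ 2 := by positivity
  have hN : 0 < r ^ 2 + s ^ 2 := by positivity
  have hβ0 : 0 < β := by
    by_contra h
    nlinarith
  have hβ1 : 1 < β := by
    by_contra h
    push Not at h
    have hN1 : 1 ≤ r ^ 2 + s ^ 2 := by nlinarith
    have : β * (2 * r) ≤ 0 := by linarith
    have hr : 2 * r ≤ 0 := by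
      by_contra h'
      push Not at h'
      nlinarith
    linarith
  refine ⟨hβ1, ?_⟩
  have hN1 : r ^ 2 + s ^ 2 < 1 := by nlinarith
  have : ‖α‖ ^ 2 < 1 := by
    rw [Complex.sq_norm, Complex.normSq_apply]
    nlinarith
  nlinarith [norm_nonneg α]

/-- Division of the sequence `e` by `1 - X + a X² - X³`. -/
def wTriple (a : ℤ) (e : ℕ → ℤ) : ℕ → ℤ × ℤ × ℤ
  | 0 => (e 0, 0, 0)
  | n + 1 =>
    let t := wTriple a e n
    (e (n + 1) + t.1 - a * t.2.1 + t.2.2, t.1, t.2.1)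

def wSeq (a : ℤ) (e : ℕ → ℤ) (n : ℕ) : ℤ := (wTriple a e n).1

lemma wSeq_zero (a : ℤ) (e : ℕ → ℤ) : wSeq a e 0 = e 0 := rfl
lemma wSeq_one (a : ℤ) (e : ℕ → ℤ) : wSeq a e 1 = e 1 + wSeq a e 0 := by
  simp [wSeq, wTriple]
lemma wSeq_two (a : ℤ) (e : ℕ → ℤ) :
    wSeq a e 2 = e 2 + wSeq a e 1 - a * wSeq a e 0 := by
  simp [wSeq, wTriple]
lemma wSeq_rec (a : ℤ) (e : ℕ → ℤ) (n : ℕ) :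
    wSeq a e (n + 3) = e (n + 3) + wSeq a e (n + 2) - a * wSeq a e (n + 1) + wSeq a e n := by
  simp [wSeq, wTriple]

lemma partial_sum (a : ℤ) (α : ℂ)
    (hroot : α ^ 3 - (a : ℂ) * α ^ 2 + α - 1 = 0) (e : ℕ → ℤ) (n : ℕ) :
    ∑ i ∈ Finset.range (n + 3), (e i : ℂ) * α ^ i =
      α ^ (n + 3) * (((wSeq a e (n + 2) : ℂ) - a * wSeq a e (n + 1) + wSeq a e n)
        + ((wSeq a e (n + 1) : ℂ) - a * wSeq a e (n + 2)) * α
        + (wSeq a e (n + 2) : ℂ) * α ^ 2) := by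
  induction n with
  | zero =>
    simp only [Finset.sum_range_succ, Finset.sum_range_zero, zero_add]
    have h0 : (wSeq a e 0 : ℂ) = e 0 := by rw [wSeq_zero]
    have h1 : (wSeq a e 1 : ℂ) = e 1 + wSeq a e 0 := by rw [wSeq_one]; push_cast; ring
    have h2 : (wSeq a e 2 : ℂ) = e 2 + wSeq a e 1 - a * wSeq a e 0 := by
      rw [wSeq_two]; push_cast; ring
    rw [h2, h1, h0]
    linear_combination (-(e 0 : ℂ) - α * (e 1 + e 0) - α ^ 2 * (e 2 + e 1 + e 0 - a * e 0)) * hroot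
  | succ n ih =>
    rw [Finset.sum_range_succ, ih]
    have h : (wSeq a e (n + 3) : ℂ) = e (n + 3) + wSeq a e (n + 2)
        - a * wSeq a e (n + 1) + wSeq a e n := by
      rw [wSeq_rec]; push_cast; ring
    have h' : (e (n + 3) : ℂ) = wSeq a e (n + 3) - wSeq a e (n + 2)
        + a * wSeq a e (n + 1) - wSeq a e n := by rw [h]; ring
    rw [show n + 1 + 2 = n + 3 from rfl, show n + 1 + 1 = n + 2 from rfl, h']
    linear_combination (-(wSeq a e (n + 3) : ℂ) * α ^ (n + 3)) * hroot

/-- The quotient sequence is bounded when the series vanishes at `α`. -/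
lemma wSeq_bounded (a : ℤ) (ha : 3 ≤ a) (α : ℂ)
    (hroot : α ^ 3 - (a : ℂ) * α ^ 2 + α - 1 = 0) (hα : α.im ≠ 0)
    (e : ℕ → ℤ) (he : ∀ n, |e n| ≤ a)
    (hsum : HasSum (fun n => (e n : ℂ) * α ^ n) 0) :
    ∃ M : ℕ, ∀ n, |wSeq a e n| ≤ M := by
  obtain ⟨hβ, hn⟩ := root_facts a ha α hroot hα
  set β : ℝ := a - 2 * α.re with hβdef
  have hα0 : α ≠ 0 := by rintro rfl; simp at hα
  have hpos : 0 < ‖α‖ := norm_pos_iff.mpr hα0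
  have hecast : ∀ n, ‖(e n : ℂ)‖ ≤ a := by
    intro n
    rw [Complex.norm_intCast]
    exact_mod_cast he n
  have hs : ∀ n, ‖((wSeq a e (n + 2) : ℂ) - a * wSeq a e (n + 1) + wSeq a e n)
        + ((wSeq a e (n + 1) : ℂ) - a * wSeq a e (n + 2)) * α
        + (wSeq a e (n + 2) : ℂ) * α ^ 2‖ ≤ a * (1 - ‖α‖)⁻¹ := by
    intro n
    set S := ((wSeq a e (n + 2) : ℂ) - a * wSeq a e (n + 1) + wSeq a e n)
        + ((wSeq a e (n + 1) : ℂ) - a * wSeq a e (n + 2)) * α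
        + (wSeq a e (n + 2) : ℂ) * α ^ 2 with hS
    have h1 := partial_sum a α hroot e n
    rw [← hS] at h1
    have h2 := (hasSum_nat_add_iff' (n + 3)).mpr hsum
    rw [h1] at h2
    have hg : HasSum (fun m => (a : ℝ) * ‖α‖ ^ (n + 3) * ‖α‖ ^ m)
        ((a : ℝ) * ‖α‖ ^ (n + 3) * (1 - ‖α‖)⁻¹) :=
      (hasSum_geometric_of_lt_one (norm_nonneg _) hn).mul_left _
    have h3 := tsum_of_norm_bounded hg (f := fun m => (e (m + (n + 3)) : ℂ) * α ^ (m + (n + 3)))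
      (by
        intro m
        rw [norm_mul, norm_pow, pow_add]
        have := hecast (m + (n + 3))
        calc _ ≤ (a : ℝ) * (‖α‖ ^ m * ‖α‖ ^ (n + 3)) := by gcongr
          _ = _ := by ring)
    rw [h2.tsum_eq] at h3
    rw [zero_sub, norm_neg, norm_mul, norm_pow] at h3
    have : 0 < ‖α‖ ^ (n + 3) := by positivity
    nlinarith
  set K : ℝ := a * (1 - ‖α‖)⁻¹ / |α.im| with hK
  have hK0 : 0 ≤ K := by
    have : 0 ≤ a * (1 - ‖α‖)⁻¹ := le_trans (norm_nonneg _) (hs 0)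
    positivity
  have hq : ∀ n, |(wSeq a e (n + 1) : ℝ) - β * wSeq a e (n + 2)| ≤ K := by
    intro n
    have h1 := (Complex.abs_im_le_norm _).trans (hs n)
    rw [hK, le_div_iff₀ (abs_pos.mpr hα), ← abs_mul]
    refine le_trans (le_of_eq ?_) h1
    congr 1
    simp [pow_two]
    rw [hβdef]; ring
  obtain ⟨M, hM⟩ := exists_nat_ge (max (max |(wSeq a e 0 : ℝ)| |(wSeq a e 1 : ℝ)|) (K / (β - 1)))
  have hM1 : |(wSeq a e 0 : ℝ)| ≤ M := le_trans (le_trans (le_max_left _ _) (le_max_left _ _)) hM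
  have hM2 : |(wSeq a e 1 : ℝ)| ≤ M := le_trans (le_trans (le_max_right _ _) (le_max_left _ _)) hM
  have hM3 : K / (β - 1) ≤ M := le_trans (le_max_right _ _) hM
  rw [div_le_iff₀ (by linarith)] at hM3
  have key : ∀ n, |(wSeq a e (n + 1) : ℝ)| ≤ M := by
    intro n
    induction n with
    | zero => exact hM2
    | succ n ih =>
      have h := hq n
      rw [abs_le] at *
      rw [show n + 1 + 1 = n + 2 from rfl]
      constructor <;> nlinarith
  refine ⟨M, fun n => ?_⟩
  rcases n with _ | n
  · exact_mod_cast hM1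
  · exact_mod_cast key n

/-- The digit inequality relaxed so that it does not depend on `a`. -/
def Relaxed (w : ℕ → ℤ) : Prop :=
  ∀ n, (w (n + 1) ≤ 0 ∨ w (n + 3) - w (n + 2) - w n ≤ -1 - 3 * (w (n + 1) - 1)) ∧
    (0 ≤ w (n + 1) ∨ 1 + 3 * (-w (n + 1) - 1) ≤ w (n + 3) - w (n + 2) - w n)

lemma relaxed_neg {w : ℕ → ℤ} (h : Relaxed w) : Relaxed (fun n => - w n) := by
  intro n
  have := h n
  dsimp only
  omega

lemma relaxed_step_pos {w : ℕ → ℤ} (h : Relaxed w) (M : ℤ) (hM : 2 ≤ M)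
    (hw0 : |w 0| ≤ 1) (hb : ∀ n, |w n| ≤ M) (n : ℕ) : w (n + 1) ≤ M - 1 := by
  by_contra hc
  have hprev : w n ≤ 1 ∨ w (n + 2) - w (n + 1) - M ≤ -1 - 3 * (w n - 1) := by
    rcases n with _ | m
    · left; exact (abs_le.mp hw0).2
    · have p1 := (h m).1
      have p2 := (abs_le.mp (hb m)).2
      simp only [add_assoc, Nat.reduceAdd] at *
      rcases p1 with p1 | p1
      · left; omega
      · right; omega
  clear hw0
  have hb' : ∀ n, -M ≤ w n ∧ w n ≤ M := fun n => abs_le.mp (hb n)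
  have b0 := hb' n
  have b1 := hb' (n + 1)
  have b2 := hb' (n + 2)
  have b3 := hb' (n + 3)
  have b4 := hb' (n + 4)
  have b5 := hb' (n + 5)
  have b6 := hb' (n + 6)
  have b7 := hb' (n + 7)
  have h0 := (h n).1
  have h1 := (h (n + 1)).1
  have h2 := (h (n + 2)).2
  have h3 := (h (n + 3)).2
  have h3' := (h (n + 3)).1
  have h4 := (h (n + 4))
  have h5 := (h (n + 5))
  have b8 := hb' (n + 8)
  simp only [add_assoc, Nat.reduceAdd] at h0 h1 h2 h3 h3' h4 h5
  generalize w n = x0 at *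
  generalize w (n + 1) = x1 at *
  generalize w (n + 2) = x2 at *
  generalize w (n + 3) = x3 at *
  generalize w (n + 4) = x4 at *
  generalize w (n + 5) = x5 at *
  generalize w (n + 6) = x6 at *
  generalize w (n + 7) = x7 at *
  generalize w (n + 8) = x8 at *
  clear h hb hb'
  have hx : x1 = M := by omega
  subst hx
  have k1 : x3 - x2 - x0 ≤ -1 - 3 * (x1 - 1) := by
    rcases h0 with h0 | h0
    · omega
    · exact h0
  clear h0 hc
  rcases lt_or_ge x1 3 with hM3 | hM3
  · have : x1 = 2 := by omega
    subst this
    have c2 : x2 = 0 ∨ x2 = 1 ∨ x2 = 2 := by omega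
    have c3 : x3 = 0 ∨ x3 = -1 ∨ x3 = -2 := by omega
    rcases c2 with rfl | rfl | rfl <;> rcases c3 with rfl | rfl | rfl <;> omega
  · have k2 : x4 - x3 - x1 ≤ -1 - 3 * (x2 - 1) := by
      rcases h1 with h1 | h1
      · omega
      · exact h1
    have k3 : 1 + 3 * (-x3 - 1) ≤ x5 - x4 - x2 := by
      rcases h2 with h2 | h2
      · omega
      · exact h2
    clear h1 h2 h3' h4 h5 hprev
    rcases h3 with h3 | h3 <;> omega

lemma relaxed_le_one {w : ℕ → ℤ} (h : Relaxed w) (h0 : |w 0| ≤ 1) (M : ℕ)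
    (hb : ∀ n, |w n| ≤ M) : ∀ n, |w n| ≤ 1 := by
  induction M with
  | zero => intro n; have := hb n; push_cast at this; omega
  | succ M ih =>
    rcases Nat.eq_zero_or_pos M with rfl | hM
    · simpa using hb
    · apply ih
      intro n
      rcases n with _ | n
      · omega
      · have p1 := relaxed_step_pos h (M + 1) (by omega) h0 (by exact_mod_cast hb) n
        have p2 := relaxed_step_pos (relaxed_neg h) (M + 1) (by omega) (by rw [abs_neg]; exact h0)
          (by intro n; rw [abs_neg]; exact_mod_cast hb n) n
        rw [abs_le]
        constructor <;> linarith

lemma relaxed_of_digits (a : ℤ) (ha : 3 ≤ a) (e : ℕ → ℤ)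
    (he : ∀ n, |e (n + 3)| ≤ a - 1) : Relaxed (wSeq a e) := by
  intro n
  have h := wSeq_rec a e n
  have h' := abs_le.mp (he n)
  generalize wSeq a e n = x0 at *
  generalize wSeq a e (n + 1) = x1 at *
  generalize wSeq a e (n + 2) = x2 at *
  generalize wSeq a e (n + 3) = x3 at *
  constructor
  · rcases le_or_gt x1 0 with hx | hx
    · exact Or.inl hx
    · right
      nlinarith [mul_nonneg (sub_nonneg.mpr ha) (by omega : 0 ≤ x1 - 1)]
  · rcases le_or_gt 0 x1 with hx | hx
    · exact Or.inl hx
    · right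
      nlinarith [mul_nonneg (sub_nonneg.mpr ha) (by omega : 0 ≤ -x1 - 1)]

/-- One half period of the (unique) pair of quotient sequences. -/
lemma half_step (a : ℤ) (ha : 3 ≤ a)
    (w2 w3 w4 u2 u3 u4 c2 c3 c4 d2 d3 d4 e2 e3 e4 : ℤ)
    (hw2 : w2 = d2 - c2 + a) (hu2 : u2 = e2 - c2)
    (hw3 : w3 = d3 - c3 + w2 - a * 0 + -1) (hu3 : u3 = e3 - c3 + u2 - a * -1 + 0)
    (hw4 : w4 = d4 - c4 + w3 - a * w2 + 0) (hu4 : u4 = e4 - c4 + u3 - a * u2 + -1)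
    (bw2 : |w2| ≤ 1) (bw3 : |w3| ≤ 1) (bw4 : |w4| ≤ 1)
    (bu2 : |u2| ≤ 1) (bu3 : |u3| ≤ 1) (bu4 : |u4| ≤ 1)
    (hc2 : 0 ≤ c2 ∧ c2 ≤ a - 1) (hc3 : 0 ≤ c3 ∧ c3 ≤ a - 1) (hc4 : 0 ≤ c4 ∧ c4 ≤ a - 1)
    (hd2 : 0 ≤ d2 ∧ d2 ≤ a - 1) (hd3 : 0 ≤ d3 ∧ d3 ≤ a - 1) (hd4 : 0 ≤ d4 ∧ d4 ≤ a - 1)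
    (he2 : 0 ≤ e2 ∧ e2 ≤ a - 1) (he3 : 0 ≤ e3 ∧ e3 ≤ a - 1) (he4 : 0 ≤ e4 ∧ e4 ≤ a - 1) :
    w2 = 1 ∧ u2 = 0 ∧ w3 = 0 ∧ u3 = 1 ∧ c2 = a - 1 ∧ c3 = a - 1 := by
  rw [abs_le] at *
  have e1 : w2 = 1 := by omega
  subst e1
  have e2' : u2 = 0 ∨ u2 = -1 := by omega
  have e3' : w3 = 0 ∨ w3 = 1 := by omega
  have e4' : u3 = 0 ∨ u3 = 1 := by rcases e2' with rfl | rfl <;> omega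
  rcases e2' with rfl | rfl <;> rcases e3' with rfl | rfl <;> rcases e4' with rfl | rfl <;> omega

def Sys (a : ℤ) (w u C D E : ℕ → ℤ) : Prop :=
  (∀ n, w (n + 3) = D (n + 3) - C (n + 3) + w (n + 2) - a * w (n + 1) + w n) ∧
  (∀ n, u (n + 3) = E (n + 3) - C (n + 3) + u (n + 2) - a * u (n + 1) + u n) ∧
  (∀ n, |w n| ≤ 1) ∧ (∀ n, |u n| ≤ 1) ∧
  (∀ n, 0 ≤ C (n + 2) ∧ C (n + 2) ≤ a - 1) ∧
  (∀ n, 0 ≤ D (n + 2) ∧ D (n + 2) ≤ a - 1) ∧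
  (∀ n, 0 ≤ E (n + 2) ∧ E (n + 2) ≤ a - 1)

def PInv (a : ℤ) (w u C D E : ℕ → ℤ) (n : ℕ) : Prop :=
  w n = -1 ∧ w (n + 1) = 0 ∧ u n = 0 ∧ u (n + 1) = -1 ∧
  w (n + 2) = D (n + 2) - C (n + 2) + a ∧ u (n + 2) = E (n + 2) - C (n + 2)

lemma sys_neg {a : ℤ} {w u C D E : ℕ → ℤ} (h : Sys a w u C D E) :
    Sys a (fun n => -w n) (fun n => -u n) (fun n => a - 1 - C n) (fun n => a - 1 - D n)
      (fun n => a - 1 - E n) := by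
  obtain ⟨h1, h2, h3, h4, h5, h6, h7⟩ := h
  refine ⟨fun n => ?_, fun n => ?_, fun n => ?_, fun n => ?_, fun n => ?_, fun n => ?_,
    fun n => ?_⟩
  · dsimp only; rw [h1 n]; ring
  · dsimp only; rw [h2 n]; ring
  · dsimp only; rw [abs_neg]; exact h3 n
  · dsimp only; rw [abs_neg]; exact h4 n
  · have := h5 n; dsimp only; omega
  · have := h6 n; dsimp only; omega
  · have := h7 n; dsimp only; omega

lemma sys_step {a : ℤ} (ha : 3 ≤ a) {w u C D E : ℕ → ℤ} (h : Sys a w u C D E) {n : ℕ}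
    (hi : PInv a w u C D E n) :
    C (n + 2) = a - 1 ∧ C (n + 3) = a - 1 ∧
    PInv a (fun n => -w n) (fun n => -u n) (fun n => a - 1 - C n) (fun n => a - 1 - D n)
      (fun n => a - 1 - E n) (n + 2) := by
  obtain ⟨h1, h2, h3, h4, h5, h6, h7⟩ := h
  obtain ⟨i1, i2, i3, i4, i5, i6⟩ := hi
  have a1 := h1 n
  have a2 := h1 (n + 1)
  have a3 := h2 n
  have a4 := h2 (n + 1)
  simp only [add_assoc, Nat.reduceAdd] at a1 a2 a3 a4
  rw [i1, i2] at a1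
  rw [i3, i4] at a3
  rw [i2] at a2
  rw [i4] at a4
  obtain ⟨r1, r2, r3, r4, r5, r6⟩ := half_step a ha _ _ _ _ _ _ _ _ _ _ _ _ _ _ _
    i5 i6 a1 a3 a2 a4 (h3 _) (h3 _) (h3 _) (h4 _) (h4 _) (h4 _)
    (h5 n) (h5 (n + 1)) (h5 (n + 2)) (h6 n) (h6 (n + 1)) (h6 (n + 2))
    (h7 n) (h7 (n + 1)) (h7 (n + 2))
  refine ⟨r5, r6, ?_, ?_, ?_, ?_, ?_, ?_⟩
  · simp [r1]
  · simp [add_assoc, r3]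
  · simp [r2]
  · simp [add_assoc, r4]
  · simp only [add_assoc, Nat.reduceAdd]
    rw [a2, r1, r3]; ring
  · simp only [add_assoc, Nat.reduceAdd]
    rw [a4, r2, r4]; ring

lemma sys_period {a : ℤ} (ha : 3 ≤ a) {w u C D E : ℕ → ℤ} (h : Sys a w u C D E)
    (hi : PInv a w u C D E 0) (k : ℕ) : PInv a w u C D E (4 * k) := by
  induction k with
  | zero => exact hi
  | succ k ih =>
    have s1 := (sys_step ha h ih).2.2
    have s2 := (sys_step ha (sys_neg h) s1).2.2
    simpa [mul_add, add_assoc] using s2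

lemma sys_digits {a : ℤ} (ha : 3 ≤ a) {w u C D E : ℕ → ℤ} (h : Sys a w u C D E)
    (hi : PInv a w u C D E 0) (n : ℕ) :
    C (n + 2) = if n % 4 < 2 then a - 1 else 0 := by
  have hk := sys_period ha h hi (n / 4)
  obtain ⟨p1, p2, s1⟩ := sys_step ha h hk
  obtain ⟨p3, p4, -⟩ := sys_step ha (sys_neg h) s1
  simp only [add_assoc, Nat.reduceAdd] at p3 p4
  have hm : n % 4 = 0 ∨ n % 4 = 1 ∨ n % 4 = 2 ∨ n % 4 = 3 := by omega
  rcases hm with hm | hm | hm | hm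
  · rw [show n + 2 = 4 * (n / 4) + 2 by omega, p1, if_pos (by omega)]
  · rw [show n + 2 = 4 * (n / 4) + 3 by omega, p2, if_pos (by omega)]
  · rw [show n + 2 = 4 * (n / 4) + 4 by omega, if_neg (by omega)]; omega
  · rw [show n + 2 = 4 * (n / 4) + 5 by omega, if_neg (by omega)]; omega

/-- Periodic digits. -/
def per (a j : ℤ) (i : ℤ) : ℤ := if (i + j) % 4 < 2 then a - 1 else 0

lemma per_admissible (a : ℤ) (ha : 3 ≤ a) (j : ℤ) : Admissible a 2 (per a j) := by
  constructor
  · intro i _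
    unfold per
    split_ifs <;> omega
  · intro i _
    unfold WordLt per
    split_ifs <;> omega

lemma digit_summable (a : ℤ) (α : ℂ) (hn : ‖α‖ < 1) (c : ℕ → ℤ)
    (hc : ∀ n, 0 ≤ c n ∧ c n ≤ a - 1) :
    Summable (fun n : ℕ => (c n : ℂ) * α ^ (n + 2)) := by
  refine Summable.of_norm_bounded (g := fun n => (a * ‖α‖ ^ 2) * ‖α‖ ^ n)
    ((summable_geometric_of_lt_one (norm_nonneg _) hn).mul_left _) ?_
  intro n
  rw [norm_mul, norm_pow, Complex.norm_intCast]
  have h1 : |(c n : ℝ)| ≤ a := by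
    have := hc n
    have h : |c n| ≤ a := by rw [abs_le]; omega
    exact_mod_cast h
  calc |(c n : ℝ)| * ‖α‖ ^ (n + 2) ≤ a * ‖α‖ ^ (n + 2) := by gcongr
    _ = _ := by ring

lemma per_tsum (a : ℤ) (ha : 3 ≤ a) (α : ℂ) (hn : ‖α‖ < 1) (j : ℤ) (z : ℂ)
    (hz : (1 - α ^ 4) * z = per a j 2 * α ^ 2 + per a j 3 * α ^ 3 + per a j 4 * α ^ 4
      + per a j 5 * α ^ 5) :
    z = ∑' n : ℕ, (per a j ((n : ℤ) + 2) : ℂ) * α ^ (n + 2) := by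
  have hs := digit_summable a α hn (fun n => per a j ((n : ℤ) + 2))
    (fun n => (per_admissible a ha j).1 _ (by omega))
  have h := hs.sum_add_tsum_nat_add 4
  set P := ∑' n : ℕ, (per a j ((n : ℤ) + 2) : ℂ) * α ^ (n + 2) with hP
  have h2 : ∑' n : ℕ, (per a j (((n + 4 : ℕ) : ℤ) + 2) : ℂ) * α ^ (n + 4 + 2) = α ^ 4 * P := by
    rw [hP, ← tsum_mul_left]
    congr 1
    ext n
    have : per a j (((n + 4 : ℕ) : ℤ) + 2) = per a j ((n : ℤ) + 2) := by
      unfold per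
      push_cast
      rw [show ((n : ℤ) + 4 + 2 + j) % 4 = ((n : ℤ) + 2 + j) % 4 by omega]
    rw [this]; ring
  rw [h2] at h
  simp [Finset.sum_range_succ] at h
  have h4 : (1 - α ^ 4) ≠ 0 := by
    intro h0
    have : ‖α ^ 4‖ = 1 := by rw [← sub_eq_zero.mp h0]; simp
    rw [norm_pow] at this
    have := pow_lt_one₀ (norm_nonneg α) hn (n := 4) (by norm_num)
    linarith
  apply mul_left_cancel₀ h4
  rw [hz]
  linear_combination h

/-- Extension of digits by zero. -/
def ext0 (c : ℤ → ℤ) (n : ℕ) : ℤ := if n < 2 then 0 else c n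

lemma ext0_hasSum (a : ℤ) (α : ℂ) (hn : ‖α‖ < 1) (c : ℤ → ℤ)
    (hc : Admissible a 2 c) :
    HasSum (fun n : ℕ => (ext0 c n : ℂ) * α ^ n)
      (∑' n : ℕ, (c ((n : ℤ) + 2) : ℂ) * α ^ (n + 2)) := by
  have hs := digit_summable a α hn (fun n => c ((n : ℤ) + 2))
    (fun n => hc.1 _ (by omega))
  rw [← hasSum_nat_add_iff' 2]
  have h0 : ∑ i ∈ Finset.range 2, (ext0 c i : ℂ) * α ^ i = 0 := by
    simp [ext0, Finset.sum_range_succ]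
  rw [h0, sub_zero]
  have hf : (fun n : ℕ => (ext0 c (n + 2) : ℂ) * α ^ (n + 2)) =
      fun n : ℕ => (c ((n : ℤ) + 2) : ℂ) * α ^ (n + 2) := by
    funext n
    simp [ext0]
  rw [hf]
  exact hs.hasSum

def dig1 (n : ℕ) : ℤ := if n = 0 then -1 else if n = 1 then 1 else 0
def dig2 (n : ℕ) : ℤ := if n = 1 then -1 else if n = 2 then 1 else 0

lemma dig1_hasSum (α : ℂ) : HasSum (fun n : ℕ => (dig1 n : ℂ) * α ^ n) (α - 1) := by
  have := hasSum_sum_of_ne_finset_zero (L := SummationFilter.unconditional ℕ) (s := Finset.range 3)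
    (f := fun n : ℕ => (dig1 n : ℂ) * α ^ n) (by
      intro n hn
      simp at hn
      have : dig1 n = 0 := by unfold dig1; rw [if_neg (by omega), if_neg (by omega)]
      simp [this])
  convert this using 1
  simp [Finset.sum_range_succ, dig1]; ring

lemma dig2_hasSum (α : ℂ) : HasSum (fun n : ℕ => (dig2 n : ℂ) * α ^ n) (α ^ 2 - α) := by
  have := hasSum_sum_of_ne_finset_zero (L := SummationFilter.unconditional ℕ) (s := Finset.range 3)
    (f := fun n : ℕ => (dig2 n : ℂ) * α ^ n) (by
      intro n hn
      simp at hn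
      have : dig2 n = 0 := by unfold dig2; rw [if_neg (by omega), if_neg (by omega)]
      simp [this])
  convert this using 1
  simp [Finset.sum_range_succ, dig2]; ring

lemma ext0_bd {a : ℤ} (ha : 3 ≤ a) {c : ℤ → ℤ} (hc : Admissible a 2 c) (n : ℕ) :
    0 ≤ ext0 c n ∧ ext0 c n ≤ a - 1 := by
  unfold ext0
  split_ifs
  · omega
  · exact hc.1 _ (by omega)

/-- The quotient sequence for a coincidence of two expansions takes values in `{-1, 0, 1}`. -/
lemma pair_bound (a : ℤ) (ha : 3 ≤ a) (α : ℂ)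
    (hroot : α ^ 3 - (a : ℂ) * α ^ 2 + α - 1 = 0) (hα : α.im ≠ 0)
    (c d : ℤ → ℤ) (hc : Admissible a 2 c) (hd : Admissible a 2 d) (V : ℕ → ℤ) (v : ℂ)
    (hV : HasSum (fun n : ℕ => (V n : ℂ) * α ^ n) v) (hV1 : ∀ n, |V n| ≤ 1)
    (hV3 : ∀ n, V (n + 3) = 0)
    (heq : ∑' n : ℕ, (c ((n : ℤ) + 2) : ℂ) * α ^ (n + 2) =
      ∑' n : ℕ, (d ((n : ℤ) + 2) : ℂ) * α ^ (n + 2) + v) (n : ℕ) :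
    |wSeq a (fun n => V n + ext0 d n - ext0 c n) n| ≤ 1 := by
  have hn := (root_facts a ha α hroot hα).2
  have hsum := (hV.add (ext0_hasSum a α hn d hd)).sub (ext0_hasSum a α hn c hc)
  rw [heq, add_comm v, sub_self] at hsum
  obtain ⟨M, hM⟩ := wSeq_bounded a ha α hroot hα (fun n => V n + ext0 d n - ext0 c n)
    (by
      intro n
      have h1 := ext0_bd ha hc n
      have h2 := ext0_bd ha hd n
      have h3 := abs_le.mp (hV1 n)
      rw [abs_le]; constructor <;> linarith)
    (by
      have hf : (fun n : ℕ => ((V n + ext0 d n - ext0 c n : ℤ) : ℂ) * α ^ n) =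
          fun b => (V b : ℂ) * α ^ b + (ext0 d b : ℂ) * α ^ b - (ext0 c b : ℂ) * α ^ b := by
        funext b
        push_cast
        ring
      rw [hf]
      exact hsum)
  refine relaxed_le_one (relaxed_of_digits a ha _ ?_) ?_ M hM n
  · intro n
    have h1 := ext0_bd ha hc (n + 3)
    have h2 := ext0_bd ha hd (n + 3)
    have h3 := hV3 n
    rw [abs_le]; constructor <;> linarith
  · rw [wSeq_zero]
    simpa [ext0] using hV1 0

theorem bset_inter_1 (a : ℤ) (ha : 3 ≤ a) (α : ℂ)
    (hroot : α ^ 3 - (a : ℂ) * α ^ 2 + α - 1 = 0) (hα : α.im ≠ 0) :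
    BSet a α (α - 1) ∩ BSet a α (α ^ 2 - α) = {-1} := by
  have hn := (root_facts a ha α hroot hα).2
  have hm1 : (-1 : ℂ) = ∑' n : ℕ, (per a 2 ((n : ℤ) + 2) : ℂ) * α ^ (n + 2) := by
    apply per_tsum a ha α hn
    norm_num [per]
    linear_combination (α + 1) * hroot
  have hm2 : (-α : ℂ) = ∑' n : ℕ, (per a 1 ((n : ℤ) + 2) : ℂ) * α ^ (n + 2) := by
    apply per_tsum a ha α hn
    norm_num [per]
    linear_combination (α * (α + 1)) * hroot
  have hm3 : (-1 + α - α ^ 2 : ℂ) = ∑' n : ℕ, (per a 3 ((n : ℤ) + 2) : ℂ) * α ^ (n + 2) := by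
    apply per_tsum a ha α hn
    norm_num [per]
    linear_combination (α ^ 3 + 1) * hroot
  apply Set.Subset.antisymm
  · rintro z ⟨⟨⟨c, hc, hzc⟩, z1, ⟨d, hd, hzd⟩, h1⟩, -, z2, ⟨e, he, hze⟩, h2⟩
    dsimp only at h1 h2
    have bw := pair_bound a ha α hroot hα c d hc hd dig1 (α - 1) (dig1_hasSum α)
      (by intro n; unfold dig1; split_ifs <;> simp) (by intro n; simp [dig1])
      (by rw [← hzc, ← hzd, h1])
    have bu := pair_bound a ha α hroot hα c e hc he dig2 (α ^ 2 - α) (dig2_hasSum α)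
      (by intro n; unfold dig2; split_ifs <;> simp) (by intro n; simp [dig2])
      (by rw [← hzc, ← hze, h2])
    set ew : ℕ → ℤ := fun n => dig1 n + ext0 d n - ext0 c n with hew
    set eu : ℕ → ℤ := fun n => dig2 n + ext0 e n - ext0 c n with heu
    have hsys : Sys a (wSeq a ew) (wSeq a eu) (ext0 c) (ext0 d) (ext0 e) := by
      refine ⟨fun n => ?_, fun n => ?_, bw, bu, fun n => ext0_bd ha hc _,
        fun n => ext0_bd ha hd _, fun n => ext0_bd ha he _⟩
      · rw [wSeq_rec]; simp [hew, dig1]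
      · rw [wSeq_rec]; simp [heu, dig2]
    have hinv : PInv a (wSeq a ew) (wSeq a eu) (ext0 c) (ext0 d) (ext0 e) 0 := by
      have w0 : wSeq a ew 0 = -1 := by simp [wSeq_zero, hew, dig1, ext0]
      have w1 : wSeq a ew 1 = 0 := by rw [wSeq_one, w0]; simp [hew, dig1, ext0]
      have u0 : wSeq a eu 0 = 0 := by simp [wSeq_zero, heu, dig2, ext0]
      have u1 : wSeq a eu 1 = -1 := by rw [wSeq_one, u0]; simp [heu, dig2, ext0]
      refine ⟨w0, w1, u0, u1, ?_, ?_⟩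
      · rw [zero_add, wSeq_two, w0, w1]; simp [hew, dig1]
      · rw [zero_add, wSeq_two, u0, u1]; simp [heu, dig2]; ring
    have hdig := sys_digits ha hsys hinv
    rw [Set.mem_singleton_iff, hzc, hm1]
    congr 1
    ext n
    have h := hdig n
    have h' : c ((n : ℤ) + 2) = per a 2 ((n : ℤ) + 2) := by
      have h3 : ext0 c (n + 2) = c ((n : ℤ) + 2) := by simp [ext0]
      rw [← h3, h]
      unfold per
      split_ifs <;> omega
    rw [h']
  · rintro z rfl
    refine ⟨⟨⟨_, per_admissible a ha 2, hm1⟩, -α, ⟨_, per_admissible a ha 1, hm2⟩, by ring⟩,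
      ⟨_, per_admissible a ha 2, hm1⟩, -1 + α - α ^ 2, ⟨_, per_admissible a ha 3, hm3⟩, by ring⟩
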